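/- Suppose the LQ mean field social optimization problem has asymptotic solvability, with threshold N₀ as in the definition, and for each N ≥ N₀ let (Λ₁^N(t), Λ₂^N(t)) be defined from the solution 𝐏 of (ODE-P) as its common diagonal n×n block and N times its common off-diagonal n×n block, respectively. Then there exist N₁ ≥ N₀ and a constant c₁ > 0 such that for all N ≥ N₁: (Λ₁^N, Λ₂^N) is a solution of the rescaled system (ODE-Λ^N) on [0,T]; sup_{N ≥ N₁} sup_{t∈[0,T]} (|Λ₁^N(t)| + |Λ₂^N(t)|) < ∞ (|·| the Frobenius norm); and ℛ₁(Λ₁^N(t)) ≥ c₁ I and ℛ₂(Λ₁^N(t), Λ₂^N(t)) ≥ c₁ I for all t ∈ [0,T]. -/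

import Mathlib

open Matrix Set

namespace LQ

/-- Frobenius norm of a real matrix. -/
noncomputable def frob {a b : Type*} [Fintype a] [Fintype b] (M : Matrix a b ℝ) : ℝ :=
  Real.sqrt (∑ i, ∑ j, (M i j) ^ 2)

/-- Entrywise ℓ₁ norm of a real matrix. -/
noncomputable def l1norm {a b : Type*} [Fintype a] [Fintype b] (M : Matrix a b ℝ) : ℝ :=
  ∑ i, ∑ j, |M i j|

/-- Block matrix with all diagonal m×m blocks equal to `F` and all off-diagonal blocks equal to `K`. -/
def blockConst (N m : ℕ) (F K : Matrix (Fin m) (Fin m) ℝ) :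
    Matrix (Fin N × Fin m) (Fin N × Fin m) ℝ :=
  Matrix.of fun x y => if x.1 = y.1 then F x.2 y.2 else K x.2 y.2

/-- Block matrix with diagonal blocks `Λ₁` and off-diagonal blocks `Λ₂ / N`. -/
noncomputable def blockPN (N n : ℕ) (Λ₁ Λ₂ : Matrix (Fin n) (Fin n) ℝ) :
    Matrix (Fin N × Fin n) (Fin N × Fin n) ℝ :=
  Matrix.of fun x y => if x.1 = y.1 then Λ₁ x.2 y.2 else Λ₂ x.2 y.2 / (N : ℝ)

/-- The permutation matrix exchanging the i-th and j-th block rows of `I_{Nn}`. -/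
def Jswap (N n : ℕ) (i j : Fin N) : Matrix (Fin N × Fin n) (Fin N × Fin n) ℝ :=
  Matrix.of fun x y => if y.1 = Equiv.swap i j x.1 ∧ y.2 = x.2 then 1 else 0

/-- `I_N ⊗ M`. -/
def kronIN (N : ℕ) {a b : ℕ} (M : Matrix (Fin a) (Fin b) ℝ) :
    Matrix (Fin N × Fin a) (Fin N × Fin b) ℝ :=
  Matrix.of fun x y => if x.1 = y.1 then M x.2 y.2 else 0

/-- `𝟏_{N×1} ⊗ M`. -/
def stackN (N : ℕ) {a b : ℕ} (M : Matrix (Fin a) (Fin b) ℝ) :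
    Matrix (Fin N × Fin a) (Fin b) ℝ :=
  Matrix.of fun x y => M x.2 y

/-- Data of the LQ mean field social optimization problem. -/
structure Params (n n₁ : ℕ) where
  A : Matrix (Fin n) (Fin n) ℝ
  G : Matrix (Fin n) (Fin n) ℝ
  Γ : Matrix (Fin n) (Fin n) ℝ
  Γf : Matrix (Fin n) (Fin n) ℝ
  B : Matrix (Fin n) (Fin n₁) ℝ
  B0 : Matrix (Fin n) (Fin n₁) ℝ
  B1 : Matrix (Fin n) (Fin n₁) ℝ
  D : Matrix (Fin n) (Fin 1) ℝ
  D0 : Matrix (Fin n) (Fin 1) ℝ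
  Q : Matrix (Fin n) (Fin n) ℝ
  Qf : Matrix (Fin n) (Fin n) ℝ
  R : Matrix (Fin n₁) (Fin n₁) ℝ
  T : ℝ

namespace Params

variable {n n₁ : ℕ} (p : Params n n₁)

/-- Standing hypotheses: positive dimensions, positive horizon, symmetric weights. -/
def Standing : Prop :=
  1 ≤ n ∧ 1 ≤ n₁ ∧ 0 < p.T ∧ p.Q.IsSymm ∧ p.Qf.IsSymm ∧ p.R.IsSymm

/-- Q^Γ = Γᵀ Q Γ − Q Γ − Γᵀ Q. -/
def QΓ : Matrix (Fin n) (Fin n) ℝ := p.Γᵀ * p.Q * p.Γ - p.Q * p.Γ - p.Γᵀ * p.Q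

/-- Q_f^Γ = Γ_fᵀ Q_f Γ_f − Q_f Γ_f − Γ_fᵀ Q_f. -/
def QfΓ : Matrix (Fin n) (Fin n) ℝ := p.Γfᵀ * p.Qf * p.Γf - p.Qf * p.Γf - p.Γfᵀ * p.Qf

/-- ℛ₁(Λ₁) = R + B₁ᵀ Λ₁ B₁. -/
def R1 (Λ₁ : Matrix (Fin n) (Fin n) ℝ) : Matrix (Fin n₁) (Fin n₁) ℝ :=
  p.R + p.B1ᵀ * Λ₁ * p.B1

/-- ℛ₂(Λ₁,Λ₂) = R + B₁ᵀ Λ₁ B₁ + B₀ᵀ(Λ₁+Λ₂)B₀. -/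
def R2 (Λ₁ Λ₂ : Matrix (Fin n) (Fin n) ℝ) : Matrix (Fin n₁) (Fin n₁) ℝ :=
  p.R + p.B1ᵀ * Λ₁ * p.B1 + p.B0ᵀ * (Λ₁ + Λ₂) * p.B0

/-- Ψ₁. -/
noncomputable def Ψ₁ (Λ₁ : Matrix (Fin n) (Fin n) ℝ) : Matrix (Fin n) (Fin n) ℝ :=
  Λ₁ * p.B * (p.R1 Λ₁)⁻¹ * p.Bᵀ * Λ₁ - Λ₁ * p.A - p.Aᵀ * Λ₁ - p.Q

/-- Ψ₂. -/
noncomputable def Ψ₂ (Λ₁ Λ₂ : Matrix (Fin n) (Fin n) ℝ) : Matrix (Fin n) (Fin n) ℝ :=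
  (Λ₁ + Λ₂) * p.B * (p.R2 Λ₁ Λ₂)⁻¹ * p.Bᵀ * (Λ₁ + Λ₂)
    - Λ₁ * p.B * (p.R1 Λ₁)⁻¹ * p.Bᵀ * Λ₁
    - (Λ₁ * p.G + Λ₂ * (p.A + p.G))
    - (p.Gᵀ * Λ₁ + (p.Aᵀ + p.Gᵀ) * Λ₂)
    - p.QΓ

/-- Solution of the limiting ODE system (ODE-Λ) on [0,T]. -/
noncomputable def IsSolLim (Λ₁ Λ₂ : ℝ → Matrix (Fin n) (Fin n) ℝ) : Prop :=
  (∀ t ∈ Icc (0 : ℝ) p.T, (Λ₁ t).IsSymm ∧ (Λ₂ t).IsSymm) ∧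
  (∀ t ∈ Icc (0 : ℝ) p.T, (p.R1 (Λ₁ t)).PosDef ∧ (p.R2 (Λ₁ t) (Λ₂ t)).PosDef) ∧
  Λ₁ p.T = p.Qf ∧ Λ₂ p.T = p.QfΓ ∧
  (∀ t ∈ Icc (0 : ℝ) p.T, ∀ i j, HasDerivWithinAt (fun s => Λ₁ s i j)
    (p.Ψ₁ (Λ₁ t) i j) (Icc (0 : ℝ) p.T) t) ∧
  (∀ t ∈ Icc (0 : ℝ) p.T, ∀ i j, HasDerivWithinAt (fun s => Λ₂ s i j)
    (p.Ψ₂ (Λ₁ t) (Λ₂ t) i j) (Icc (0 : ℝ) p.T) t)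

/-! Big (N-agent) matrices. -/

noncomputable def bigA (N : ℕ) : Matrix (Fin N × Fin n) (Fin N × Fin n) ℝ :=
  Matrix.of fun x y => (if x.1 = y.1 then p.A x.2 y.2 else 0) + p.G x.2 y.2 / (N : ℝ)

def bigBhat (N : ℕ) : Matrix (Fin N × Fin n) (Fin N × Fin n₁) ℝ :=
  Matrix.of fun x y => if x.1 = y.1 then p.B x.2 y.2 else 0

def bigB (N : ℕ) (i : Fin N) : Matrix (Fin N × Fin n) (Fin n₁) ℝ :=
  Matrix.of fun x l => if x.1 = i then p.B1 x.2 l else 0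

noncomputable def bigB0 (N : ℕ) : Matrix (Fin N × Fin n) (Fin n₁) ℝ :=
  Matrix.of fun x l => p.B0 x.2 l / (N : ℝ)

def bigD (N : ℕ) (i : Fin N) : Matrix (Fin N × Fin n) (Fin 1) ℝ :=
  Matrix.of fun x l => if x.1 = i then p.D x.2 l else 0

def bigD0 (N : ℕ) : Matrix (Fin N × Fin n) (Fin 1) ℝ :=
  Matrix.of fun x l => p.D0 x.2 l

def bigE (_p : Params n n₁) (N : ℕ) (i : Fin N) : Matrix (Fin n₁) (Fin N × Fin n₁) ℝ :=
  Matrix.of fun k y => if y.1 = i ∧ y.2 = k then 1 else 0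

def bigIhat (_p : Params n n₁) (N : ℕ) : Matrix (Fin n₁) (Fin N × Fin n₁) ℝ :=
  Matrix.of fun k y => if y.2 = k then 1 else 0

noncomputable def bigQ (N : ℕ) : Matrix (Fin N × Fin n) (Fin N × Fin n) ℝ :=
  Matrix.of fun x y => (if x.1 = y.1 then p.Q x.2 y.2 else 0) + p.QΓ x.2 y.2 / (N : ℝ)

noncomputable def bigQf (N : ℕ) : Matrix (Fin N × Fin n) (Fin N × Fin n) ℝ :=
  Matrix.of fun x y => (if x.1 = y.1 then p.Qf x.2 y.2 else 0) + p.QfΓ x.2 y.2 / (N : ℝ)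

def bigR (N : ℕ) : Matrix (Fin N × Fin n₁) (Fin N × Fin n₁) ℝ :=
  Matrix.of fun x y => if x.1 = y.1 then p.R x.2 y.2 else 0

/-- 𝓜₀. -/
noncomputable def M0 (N : ℕ) (Z : Matrix (Fin N × Fin n) (Fin N × Fin n) ℝ) :
    Matrix (Fin 1) (Fin 1) ℝ :=
  (1 / 2 : ℝ) • (∑ i : Fin N, (p.bigD N i)ᵀ * Z * p.bigD N i)
    + (1 / 2 : ℝ) • ((p.bigD0 N)ᵀ * Z * p.bigD0 N)

/-- 𝓜₁. -/
noncomputable def M1 (N : ℕ) (Z : Matrix (Fin N × Fin n) (Fin N × Fin n) ℝ) :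
    Matrix (Fin 1) (Fin N × Fin n₁) ℝ :=
  (∑ i : Fin N, (p.bigD N i)ᵀ * Z * p.bigB N i * p.bigE N i)
    + (p.bigD0 N)ᵀ * Z * p.bigB0 N * p.bigIhat N

/-- 𝓜₂. -/
noncomputable def M2 (N : ℕ) (Z : Matrix (Fin N × Fin n) (Fin N × Fin n) ℝ) :
    Matrix (Fin N × Fin n₁) (Fin N × Fin n₁) ℝ :=
  (1 / 2 : ℝ) • (∑ i : Fin N, (p.bigE N i)ᵀ * (p.bigB N i)ᵀ * Z * p.bigB N i * p.bigE N i)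
    + (1 / 2 : ℝ) • ((p.bigIhat N)ᵀ * (p.bigB0 N)ᵀ * Z * p.bigB0 N * p.bigIhat N)

/-- Right-hand side of the Riccati equation (ODE-P). -/
noncomputable def PRic (N : ℕ) (P : Matrix (Fin N × Fin n) (Fin N × Fin n) ℝ) :
    Matrix (Fin N × Fin n) (Fin N × Fin n) ℝ :=
  P * p.bigBhat N * (p.bigR N + (2 : ℝ) • p.M2 N P)⁻¹ * (p.bigBhat N)ᵀ * P
    - P * p.bigA N - (p.bigA N)ᵀ * P - p.bigQ N

/-- Solution of the large-scale Riccati equation (ODE-P) on [0,T]. -/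
noncomputable def IsSolP (N : ℕ) (P : ℝ → Matrix (Fin N × Fin n) (Fin N × Fin n) ℝ) : Prop :=
  (∀ t ∈ Icc (0 : ℝ) p.T, (P t).IsSymm) ∧
  (∀ t ∈ Icc (0 : ℝ) p.T, (p.bigR N + (2 : ℝ) • p.M2 N (P t)).PosDef) ∧
  P p.T = p.bigQf N ∧
  (∀ t ∈ Icc (0 : ℝ) p.T, ∀ x y, HasDerivWithinAt (fun s => P s x y)
    (p.PRic N (P t) x y) (Icc (0 : ℝ) p.T) t)

/-- Solution of the companion linear equation (ODE-S) on [0,T], relative to `P`. -/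
noncomputable def IsSolS (N : ℕ) (P : ℝ → Matrix (Fin N × Fin n) (Fin N × Fin n) ℝ)
    (S : ℝ → Matrix (Fin N × Fin n) (Fin 1) ℝ) : Prop :=
  S p.T = 0 ∧
  (∀ t ∈ Icc (0 : ℝ) p.T, ∀ x y, HasDerivWithinAt (fun s => S s x y)
    ((P t * p.bigBhat N * (p.bigR N + (2 : ℝ) • p.M2 N (P t))⁻¹ *
        ((p.bigBhat N)ᵀ * S t + (p.M1 N (P t))ᵀ) - (p.bigA N)ᵀ * S t) x y)
    (Icc (0 : ℝ) p.T) t)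

/-- Solution of the companion scalar equation (ODE-r) on [0,T], relative to `P` and `S`. -/
noncomputable def IsSolr (N : ℕ) (P : ℝ → Matrix (Fin N × Fin n) (Fin N × Fin n) ℝ)
    (S : ℝ → Matrix (Fin N × Fin n) (Fin 1) ℝ) (r : ℝ → ℝ) : Prop :=
  r p.T = 0 ∧
  (∀ t ∈ Icc (0 : ℝ) p.T, HasDerivWithinAt r
    (((((S t)ᵀ * p.bigBhat N + p.M1 N (P t)) * (p.bigR N + (2 : ℝ) • p.M2 N (P t))⁻¹ *
        ((p.bigBhat N)ᵀ * S t + (p.M1 N (P t))ᵀ)) - (2 : ℝ) • p.M0 N (P t)) 0 0)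
    (Icc (0 : ℝ) p.T) t)

/-- Asymptotic solvability of the LQ mean field social optimization problem. -/
noncomputable def AsympSolvable : Prop :=
  ∃ N₀ : ℕ, 1 ≤ N₀ ∧ ∃ c₀ : ℝ, 0 < c₀ ∧ ∃ C : ℝ,
    ∀ N : ℕ, N₀ ≤ N →
      ∃ P : ℝ → Matrix (Fin N × Fin n) (Fin N × Fin n) ℝ,
        p.IsSolP N P ∧
        (∀ t ∈ Icc (0 : ℝ) p.T, l1norm (P t) / (N : ℝ) ≤ C) ∧
        (∀ t ∈ Icc (0 : ℝ) p.T,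
          (p.bigR N + (2 : ℝ) • p.M2 N (P t) - c₀ • 1).PosSemidef)

/-! The rescaled low-dimensional system. -/

/-- E^N. -/
noncomputable def EN (N : ℕ) (Λ₁ Λ₂ : Matrix (Fin n) (Fin n) ℝ) :
    Matrix (Fin n₁) (Fin n₁) ℝ :=
  (1 / (N : ℝ)) •
    ((p.R2 Λ₁ Λ₂ - (1 / (N : ℝ)) • (p.B0ᵀ * Λ₂ * p.B0))⁻¹ - (p.R1 Λ₁)⁻¹)

/-- H^N. -/
noncomputable def HN (N : ℕ) (Λ₁ Λ₂ : Matrix (Fin n) (Fin n) ℝ) :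
    Matrix (Fin n₁) (Fin n₁) ℝ :=
  p.EN N Λ₁ Λ₂ + (p.R1 Λ₁)⁻¹

/-- g₁. -/
noncomputable def g₁ (N : ℕ) (Λ₁ Λ₂ : Matrix (Fin n) (Fin n) ℝ) :
    Matrix (Fin n) (Fin n) ℝ :=
  Λ₁ * p.B * p.EN N Λ₁ Λ₂ * p.Bᵀ * Λ₁
  + (1 - 1 / (N : ℝ)) •
      (Λ₂ * p.B * p.EN N Λ₁ Λ₂ * p.Bᵀ * Λ₁ + Λ₁ * p.B * p.EN N Λ₁ Λ₂ * p.Bᵀ * Λ₂)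
  + (1 / (N : ℝ) - 1 / (N : ℝ) ^ 2) •
      (Λ₂ * p.B * (p.HN N Λ₁ Λ₂ + ((N : ℝ) - 2) • p.EN N Λ₁ Λ₂) * p.Bᵀ * Λ₂)
  - (1 / (N : ℝ)) •
      ((Λ₁ * p.G + p.Gᵀ * Λ₁) + (1 - 1 / (N : ℝ)) • (Λ₂ * p.G + p.Gᵀ * Λ₂))
  - (1 / (N : ℝ)) • p.QΓ

/-- g₂. -/
noncomputable def g₂ (N : ℕ) (Λ₁ Λ₂ : Matrix (Fin n) (Fin n) ℝ) :
    Matrix (Fin n) (Fin n) ℝ :=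
  (Λ₁ + Λ₂) * p.B *
      ((N : ℝ) • p.EN N Λ₁ Λ₂ + (p.R1 Λ₁)⁻¹ - (p.R2 Λ₁ Λ₂)⁻¹) * p.Bᵀ * (Λ₁ + Λ₂)
  - (2 / (N : ℝ)) • (Λ₂ * p.B * (p.R1 Λ₁)⁻¹ * p.Bᵀ * Λ₂)
  + (1 / (N : ℝ) - 2) • (Λ₂ * p.B * p.EN N Λ₁ Λ₂ * p.Bᵀ * Λ₂)
  - Λ₁ * p.B * p.EN N Λ₁ Λ₂ * p.Bᵀ * Λ₂
  - Λ₂ * p.B * p.EN N Λ₁ Λ₂ * p.Bᵀ * Λ₁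
  + (1 / (N : ℝ)) • (Λ₂ * p.G + p.Gᵀ * Λ₂)

/-- Solution of the rescaled system (ODE-Λ^N) on [0,T]. -/
noncomputable def IsSolLamN (N : ℕ) (Λ₁ Λ₂ : ℝ → Matrix (Fin n) (Fin n) ℝ) : Prop :=
  (∀ t ∈ Icc (0 : ℝ) p.T, (Λ₁ t).IsSymm ∧ (Λ₂ t).IsSymm) ∧
  (∀ t ∈ Icc (0 : ℝ) p.T, (p.R1 (Λ₁ t)).PosDef ∧ (p.R2 (Λ₁ t) (Λ₂ t)).PosDef ∧
    (p.R2 (Λ₁ t) (Λ₂ t) - (1 / (N : ℝ)) • (p.B0ᵀ * Λ₂ t * p.B0)).PosDef) ∧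
  Λ₁ p.T = p.Qf + (1 / (N : ℝ)) • p.QfΓ ∧ Λ₂ p.T = p.QfΓ ∧
  (∀ t ∈ Icc (0 : ℝ) p.T, ∀ i j, HasDerivWithinAt (fun s => Λ₁ s i j)
    ((p.Ψ₁ (Λ₁ t) + p.g₁ N (Λ₁ t) (Λ₂ t)) i j) (Icc (0 : ℝ) p.T) t) ∧
  (∀ t ∈ Icc (0 : ℝ) p.T, ∀ i j, HasDerivWithinAt (fun s => Λ₂ s i j)
    ((p.Ψ₂ (Λ₁ t) (Λ₂ t) + p.g₂ N (Λ₁ t) (Λ₂ t)) i j) (Icc (0 : ℝ) p.T) t)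

/-! Companion (mean-field) equations. -/

/-- φ₁. -/
noncomputable def φ₁ (Λ₁ Λ₂ : Matrix (Fin n) (Fin n) ℝ) (S : Matrix (Fin n) (Fin 1) ℝ) :
    Matrix (Fin n) (Fin 1) ℝ :=
  (Λ₁ + Λ₂) * p.B * (p.R2 Λ₁ Λ₂)⁻¹ *
      (p.Bᵀ * S + p.B1ᵀ * Λ₁ * p.D + p.B0ᵀ * (Λ₁ + Λ₂) * p.D0)
    - (p.A + p.G)ᵀ * S

/-- φ₂. -/
noncomputable def φ₂ (Λ₁ Λ₂ : Matrix (Fin n) (Fin n) ℝ) (S : Matrix (Fin n) (Fin 1) ℝ) :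
    Matrix (Fin 1) (Fin 1) ℝ :=
  (Sᵀ * p.B + p.Dᵀ * Λ₁ * p.B1 + p.D0ᵀ * (Λ₁ + Λ₂) * p.B0) * (p.R2 Λ₁ Λ₂)⁻¹ *
      (p.Bᵀ * S + p.B1ᵀ * Λ₁ * p.D + p.B0ᵀ * (Λ₁ + Λ₂) * p.D0)
    - p.Dᵀ * Λ₁ * p.D - p.D0ᵀ * (Λ₁ + Λ₂) * p.D0

/-- Solution of the limiting companion system (ODE-Sr) on [0,T]. -/
noncomputable def IsSolSr (Λ₁ Λ₂ : ℝ → Matrix (Fin n) (Fin n) ℝ)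
    (S : ℝ → Matrix (Fin n) (Fin 1) ℝ) (r : ℝ → ℝ) : Prop :=
  S p.T = 0 ∧ r p.T = 0 ∧
  (∀ t ∈ Icc (0 : ℝ) p.T, ∀ i j, HasDerivWithinAt (fun s => S s i j)
    (p.φ₁ (Λ₁ t) (Λ₂ t) (S t) i j) (Icc (0 : ℝ) p.T) t) ∧
  (∀ t ∈ Icc (0 : ℝ) p.T, HasDerivWithinAt r
    ((p.φ₂ (Λ₁ t) (Λ₂ t) (S t)) 0 0) (Icc (0 : ℝ) p.T) t)

/-- g₀₁. -/
noncomputable def g01 (N : ℕ) (Λ₁ Λ₂ : Matrix (Fin n) (Fin n) ℝ)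
    (S : Matrix (Fin n) (Fin 1) ℝ) : Matrix (Fin n) (Fin 1) ℝ :=
  (Λ₁ + (1 - 1 / (N : ℝ)) • Λ₂) * p.B *
      (p.R2 Λ₁ Λ₂ - (1 / (N : ℝ)) • (p.B0ᵀ * Λ₂ * p.B0))⁻¹ *
      (p.Bᵀ * S + p.B1ᵀ * Λ₁ * p.D + p.B0ᵀ * (Λ₁ + (1 - 1 / (N : ℝ)) • Λ₂) * p.D0)
  - (Λ₁ + Λ₂) * p.B * (p.R2 Λ₁ Λ₂)⁻¹ *
      (p.Bᵀ * S + p.B1ᵀ * Λ₁ * p.D + p.B0ᵀ * (Λ₁ + Λ₂) * p.D0)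

/-- g₀₂. -/
noncomputable def g02 (N : ℕ) (Λ₁ Λ₂ : Matrix (Fin n) (Fin n) ℝ)
    (S : Matrix (Fin n) (Fin 1) ℝ) : Matrix (Fin 1) (Fin 1) ℝ :=
  (Sᵀ * p.B + p.Dᵀ * Λ₁ * p.B1 + p.D0ᵀ * (Λ₁ + (1 - 1 / (N : ℝ)) • Λ₂) * p.B0) *
      (p.R2 Λ₁ Λ₂ - (1 / (N : ℝ)) • (p.B0ᵀ * Λ₂ * p.B0))⁻¹ *
      (p.Bᵀ * S + p.B1ᵀ * Λ₁ * p.D + p.B0ᵀ * (Λ₁ + (1 - 1 / (N : ℝ)) • Λ₂) * p.D0)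
  - (Sᵀ * p.B + p.Dᵀ * Λ₁ * p.B1 + p.D0ᵀ * (Λ₁ + Λ₂) * p.B0) * (p.R2 Λ₁ Λ₂)⁻¹ *
      (p.Bᵀ * S + p.B1ᵀ * Λ₁ * p.D + p.B0ᵀ * (Λ₁ + Λ₂) * p.D0)
  + (1 / (N : ℝ)) • (p.D0ᵀ * Λ₂ * p.D0)

/-- Solution of the rescaled companion system (ODE-S^N r^N) on [0,T]. -/
noncomputable def IsSolSrN (N : ℕ) (Λ₁ Λ₂ : ℝ → Matrix (Fin n) (Fin n) ℝ)
    (S : ℝ → Matrix (Fin n) (Fin 1) ℝ) (r : ℝ → ℝ) : Prop :=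
  S p.T = 0 ∧ r p.T = 0 ∧
  (∀ t ∈ Icc (0 : ℝ) p.T, ∀ i j, HasDerivWithinAt (fun s => S s i j)
    ((p.φ₁ (Λ₁ t) (Λ₂ t) (S t) + p.g01 N (Λ₁ t) (Λ₂ t) (S t)) i j) (Icc (0 : ℝ) p.T) t) ∧
  (∀ t ∈ Icc (0 : ℝ) p.T, HasDerivWithinAt r
    ((p.φ₂ (Λ₁ t) (Λ₂ t) (S t) + p.g02 N (Λ₁ t) (Λ₂ t) (S t)) 0 0) (Icc (0 : ℝ) p.T) t)

/-! Feedback gains. -/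

/-- Θ = ℛ₁(Λ₁)⁻¹ Bᵀ Λ₁. -/
noncomputable def Theta (Λ₁ : Matrix (Fin n) (Fin n) ℝ) : Matrix (Fin n₁) (Fin n) ℝ :=
  (p.R1 Λ₁)⁻¹ * p.Bᵀ * Λ₁

/-- Θ₁ = (H₁ − H)Bᵀ(Λ₁+Λ₂) + HBᵀΛ₂. -/
noncomputable def Theta1 (Λ₁ Λ₂ : Matrix (Fin n) (Fin n) ℝ) : Matrix (Fin n₁) (Fin n) ℝ :=
  ((p.R2 Λ₁ Λ₂)⁻¹ - (p.R1 Λ₁)⁻¹) * p.Bᵀ * (Λ₁ + Λ₂) + (p.R1 Λ₁)⁻¹ * p.Bᵀ * Λ₂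

/-- Θ₂ = H₁[BᵀS + B₁ᵀΛ₁D + B₀ᵀ(Λ₁+Λ₂)D₀]. -/
noncomputable def Theta2 (Λ₁ Λ₂ : Matrix (Fin n) (Fin n) ℝ) (S : Matrix (Fin n) (Fin 1) ℝ) :
    Matrix (Fin n₁) (Fin 1) ℝ :=
  (p.R2 Λ₁ Λ₂)⁻¹ * (p.Bᵀ * S + p.B1ᵀ * Λ₁ * p.D + p.B0ᵀ * (Λ₁ + Λ₂) * p.D0)

/-- Θ^N. -/
noncomputable def ThetaN (N : ℕ) (Λ₁ Λ₂ : Matrix (Fin n) (Fin n) ℝ) :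
    Matrix (Fin n₁) (Fin n) ℝ :=
  (p.HN N Λ₁ Λ₂ - p.EN N Λ₁ Λ₂) * p.Bᵀ * (Λ₁ - (1 / (N : ℝ)) • Λ₂)

/-- Θ₁^N. -/
noncomputable def Theta1N (N : ℕ) (Λ₁ Λ₂ : Matrix (Fin n) (Fin n) ℝ) :
    Matrix (Fin n₁) (Fin n) ℝ :=
  (N : ℝ) • (p.EN N Λ₁ Λ₂ * p.Bᵀ * Λ₁)
    + (p.HN N Λ₁ Λ₂ + ((N : ℝ) - 2) • p.EN N Λ₁ Λ₂) * p.Bᵀ * Λ₂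

/-- Θ₂^N. -/
noncomputable def Theta2N (N : ℕ) (Λ₁ Λ₂ : Matrix (Fin n) (Fin n) ℝ)
    (S : Matrix (Fin n) (Fin 1) ℝ) : Matrix (Fin n₁) (Fin 1) ℝ :=
  (p.HN N Λ₁ Λ₂ + ((N : ℝ) - 1) • p.EN N Λ₁ Λ₂) *
    (p.Bᵀ * S + p.B1ᵀ * Λ₁ * p.D + p.B0ᵀ * (Λ₁ + (1 - 1 / (N : ℝ)) • Λ₂) * p.D0)

/-- Z₀ = −B₀(Θ + Θ₁). -/
noncomputable def Z0 (Λ₁ Λ₂ : Matrix (Fin n) (Fin n) ℝ) : Matrix (Fin n) (Fin n) ℝ :=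
  -(p.B0 * (p.Theta Λ₁ + p.Theta1 Λ₁ Λ₂))

/-- Z₁ = A + G − B(Θ + Θ₁). -/
noncomputable def Z1 (Λ₁ Λ₂ : Matrix (Fin n) (Fin n) ℝ) : Matrix (Fin n) (Fin n) ℝ :=
  p.A + p.G - p.B * (p.Theta Λ₁ + p.Theta1 Λ₁ Λ₂)

/-! The high-dimensional equations under the decentralized control. -/

/-- RHS of (ODE-P̌₁) (paper's −d𝐏̌₁/dt). -/
noncomputable def Pcheck1RHS (N : ℕ) (Θ : Matrix (Fin n₁) (Fin n) ℝ)
    (P1 : Matrix (Fin N × Fin n) (Fin N × Fin n) ℝ) :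
    Matrix (Fin N × Fin n) (Fin N × Fin n) ℝ :=
  (kronIN N Θ)ᵀ * (p.bigR N + p.M2 N ((2 : ℝ) • P1)) * kronIN N Θ
    + P1 * (p.bigA N - p.bigBhat N * kronIN N Θ)
    + (p.bigA N - p.bigBhat N * kronIN N Θ)ᵀ * P1
    + p.bigQ N

/-- Solution of (ODE-P̌₁) on [0,T], with Θ(t) built from Λ₁(t). -/
noncomputable def IsSolPcheck1 (N : ℕ) (Λ₁ : ℝ → Matrix (Fin n) (Fin n) ℝ)
    (P1 : ℝ → Matrix (Fin N × Fin n) (Fin N × Fin n) ℝ) : Prop :=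
  P1 p.T = p.bigQf N ∧
  (∀ t ∈ Icc (0 : ℝ) p.T, ∀ x y, HasDerivWithinAt (fun s => P1 s x y)
    ((-(p.Pcheck1RHS N (p.Theta (Λ₁ t)) (P1 t))) x y) (Icc (0 : ℝ) p.T) t)

/-- RHS of (ODE-P̌₁₂) (paper's −d𝐏̌₁₂/dt). -/
noncomputable def Pcheck12RHS (N : ℕ) (Λ₁m Λ₂m : Matrix (Fin n) (Fin n) ℝ)
    (P1 : Matrix (Fin N × Fin n) (Fin N × Fin n) ℝ)
    (P12 : Matrix (Fin N × Fin n) (Fin n) ℝ) :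
    Matrix (Fin N × Fin n) (Fin n) ℝ :=
  (kronIN N (p.Theta Λ₁m))ᵀ * (p.bigR N + p.M2 N ((2 : ℝ) • P1)) *
      stackN N (p.Theta1 Λ₁m Λ₂m)
    - P1 * p.bigBhat N * stackN N (p.Theta1 Λ₁m Λ₂m)
    + ((p.bigA N)ᵀ - (kronIN N (p.Theta Λ₁m))ᵀ * (p.bigBhat N)ᵀ) * P12
    + P12 * p.Z1 Λ₁m Λ₂m
    - (kronIN N (p.Theta Λ₁m))ᵀ * (p.bigIhat N)ᵀ * (p.bigB0 N)ᵀ * P12 * p.Z0 Λ₁m Λ₂m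

/-- Solution of (ODE-P̌₁₂) on [0,T]. -/
noncomputable def IsSolPcheck12 (N : ℕ) (Λ₁ Λ₂ : ℝ → Matrix (Fin n) (Fin n) ℝ)
    (P1 : ℝ → Matrix (Fin N × Fin n) (Fin N × Fin n) ℝ)
    (P12 : ℝ → Matrix (Fin N × Fin n) (Fin n) ℝ) : Prop :=
  P12 p.T = 0 ∧
  (∀ t ∈ Icc (0 : ℝ) p.T, ∀ x y, HasDerivWithinAt (fun s => P12 s x y)
    ((-(p.Pcheck12RHS N (Λ₁ t) (Λ₂ t) (P1 t) (P12 t))) x y) (Icc (0 : ℝ) p.T) t)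

/-! The decentralized-control low-dimensional coefficient system. -/

/-- ǧ₁. -/
noncomputable def gc1 (N : ℕ) (Θ : Matrix (Fin n₁) (Fin n) ℝ)
    (L1 L2 : Matrix (Fin n) (Fin n) ℝ) : Matrix (Fin n) (Fin n) ℝ :=
  (1 / (N : ℝ)) •
    (Θᵀ * p.B0ᵀ * (L1 + (1 - 1 / (N : ℝ)) • L2) * p.B0 * Θ
      + (L1 + (1 - 1 / (N : ℝ)) • L2) * p.G
      + p.Gᵀ * (L1 + (1 - 1 / (N : ℝ)) • L2)
      + p.QΓ)

/-- ǧ₂. -/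
noncomputable def gc2 (N : ℕ) (Θ : Matrix (Fin n₁) (Fin n) ℝ)
    (L2 : Matrix (Fin n) (Fin n) ℝ) : Matrix (Fin n) (Fin n) ℝ :=
  -((1 / (N : ℝ)) • (Θᵀ * p.B0ᵀ * L2 * p.B0 * Θ + L2 * p.G + p.Gᵀ * L2))

/-- ǧ₁₂. -/
noncomputable def gc12 (N : ℕ) (Θ Θ₁ : Matrix (Fin n₁) (Fin n) ℝ)
    (L2 : Matrix (Fin n) (Fin n) ℝ) : Matrix (Fin n) (Fin n) ℝ :=
  (1 / (N : ℝ)) • (-(Θᵀ * p.B0ᵀ * L2 * p.B0 * Θ₁) + L2 * p.B * Θ₁)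

/-- ǧ₂₂. -/
noncomputable def gc22 (N : ℕ) (Θ₁ : Matrix (Fin n₁) (Fin n) ℝ)
    (L2 : Matrix (Fin n) (Fin n) ℝ) : Matrix (Fin n) (Fin n) ℝ :=
  -((1 / (N : ℝ)) • (Θ₁ᵀ * p.B0ᵀ * L2 * p.B0 * Θ₁))

/-- ǧ₀₁. -/
noncomputable def gc01 (N : ℕ) (Θ : Matrix (Fin n₁) (Fin n) ℝ)
    (Θ₂ : Matrix (Fin n₁) (Fin 1) ℝ) (L2 : Matrix (Fin n) (Fin n) ℝ) :
    Matrix (Fin n) (Fin 1) ℝ :=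
  (1 / (N : ℝ)) • (Θᵀ * p.B0ᵀ * L2 * (p.D0 - p.B0 * Θ₂) + L2 * p.B * Θ₂)

/-- ǧ₀₂. -/
noncomputable def gc02 (N : ℕ) (Θ₁ : Matrix (Fin n₁) (Fin n) ℝ)
    (Θ₂ : Matrix (Fin n₁) (Fin 1) ℝ) (L2 : Matrix (Fin n) (Fin n) ℝ) :
    Matrix (Fin n) (Fin 1) ℝ :=
  (1 / (N : ℝ)) • (-(Θ₁ᵀ * p.B0ᵀ * L2 * p.B0 * Θ₂) + Θ₁ᵀ * p.B0ᵀ * L2 * p.D0)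

/-- RHS of (ODE-Λ̌₁^N) (paper's −dΛ̌₁^N/dt). -/
noncomputable def check1RHS (N : ℕ) (Θ : Matrix (Fin n₁) (Fin n) ℝ)
    (L1 L2 : Matrix (Fin n) (Fin n) ℝ) : Matrix (Fin n) (Fin n) ℝ :=
  Θᵀ * p.R1 L1 * Θ + L1 * (p.A - p.B * Θ) + (p.A - p.B * Θ)ᵀ * L1 + p.Q
    + p.gc1 N Θ L1 L2

/-- RHS of (ODE-Λ̌₂^N). -/
noncomputable def check2RHS (N : ℕ) (Θ : Matrix (Fin n₁) (Fin n) ℝ)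
    (L1 L2 : Matrix (Fin n) (Fin n) ℝ) : Matrix (Fin n) (Fin n) ℝ :=
  Θᵀ * p.B0ᵀ * (L1 + L2) * p.B0 * Θ + L1 * p.G + p.Gᵀ * L1
    + L2 * (p.A + p.G - p.B * Θ) + (p.A + p.G - p.B * Θ)ᵀ * L2 + p.QΓ
    + p.gc2 N Θ L2

/-- RHS of (ODE-Λ̌₁₂^N). -/
noncomputable def check12RHS (N : ℕ) (Θ Θ₁ : Matrix (Fin n₁) (Fin n) ℝ)
    (L1 L2 L12 : Matrix (Fin n) (Fin n) ℝ) : Matrix (Fin n) (Fin n) ℝ :=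
  Θᵀ * p.R2 L1 L2 * Θ₁ + Θᵀ * p.B0ᵀ * L12 * p.B0 * (Θ + Θ₁)
    - (L1 + L2) * p.B * Θ₁
    + (p.A + p.G - p.B * Θ)ᵀ * L12
    + L12 * (p.A + p.G - p.B * (Θ₁ + Θ))
    + p.gc12 N Θ Θ₁ L2

/-- RHS of (ODE-Λ̌₂₂^N). -/
noncomputable def check22RHS (N : ℕ) (Θ₁ : Matrix (Fin n₁) (Fin n) ℝ)
    (Z₀ Z₁ : Matrix (Fin n) (Fin n) ℝ)
    (L1 L2 L12 L22 : Matrix (Fin n) (Fin n) ℝ) : Matrix (Fin n) (Fin n) ℝ :=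
  Θ₁ᵀ * p.R2 L1 L2 * Θ₁ - L12ᵀ * p.B * Θ₁ - Θ₁ᵀ * p.Bᵀ * L12
    + L22 * Z₁ + Z₁ᵀ * L22
    - Z₀ᵀ * L12ᵀ * p.B0 * Θ₁ - Θ₁ᵀ * p.B0ᵀ * L12 * Z₀
    + Z₀ᵀ * L22 * Z₀ + p.gc22 N Θ₁ L2

/-- RHS of (ODE-Š₁^N). -/
noncomputable def checkS1RHS (N : ℕ) (Θ : Matrix (Fin n₁) (Fin n) ℝ)
    (Θ₂ : Matrix (Fin n₁) (Fin 1) ℝ) (L1 L2 L12 : Matrix (Fin n) (Fin n) ℝ)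
    (S1 : Matrix (Fin n) (Fin 1) ℝ) : Matrix (Fin n) (Fin 1) ℝ :=
  Θᵀ * p.R2 L1 L2 * Θ₂ - (L1 + L2 + L12) * p.B * Θ₂
    - Θᵀ * (p.Bᵀ * S1 + p.B1ᵀ * L1 * p.D + p.B0ᵀ * (L1 + L2) * p.D0)
    - Θᵀ * p.B0ᵀ * L12 * (p.D0 - p.B0 * Θ₂)
    + (p.A + p.G)ᵀ * S1
    + p.gc01 N Θ Θ₂ L2

/-- RHS of (ODE-Š₂^N). -/
noncomputable def checkS2RHS (N : ℕ) (Θ₁ : Matrix (Fin n₁) (Fin n) ℝ)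
    (Θ₂ : Matrix (Fin n₁) (Fin 1) ℝ) (Z₀ Z₁ : Matrix (Fin n) (Fin n) ℝ)
    (L1 L2 L12 L22 : Matrix (Fin n) (Fin n) ℝ)
    (S1 S2 : Matrix (Fin n) (Fin 1) ℝ) : Matrix (Fin n) (Fin 1) ℝ :=
  Θ₁ᵀ * p.R2 L1 L2 * Θ₂ + Z₁ᵀ * S2
    - Θ₁ᵀ * (p.Bᵀ * S1 + p.B1ᵀ * L1 * p.D + p.B0ᵀ * (L1 + L2) * p.D0)
    + (Z₀ᵀ * L22 + Z₀ᵀ * L12ᵀ - Θ₁ᵀ * p.B0ᵀ * L12) * (p.D0 - p.B0 * Θ₂)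
    - (L12ᵀ + L22) * p.B * Θ₂
    + p.gc02 N Θ₁ Θ₂ L2

/-- Solution of the pair (ODE-Λ̌₁^N)–(ODE-Λ̌₂^N) on [0,T], with Θ(t) from the limiting Λ₁. -/
noncomputable def IsSolCheckA (N : ℕ) (Λ₁ : ℝ → Matrix (Fin n) (Fin n) ℝ)
    (L1 L2 : ℝ → Matrix (Fin n) (Fin n) ℝ) : Prop :=
  L1 p.T = p.Qf + (1 / (N : ℝ)) • p.QfΓ ∧ L2 p.T = p.QfΓ ∧
  (∀ t ∈ Icc (0 : ℝ) p.T, ∀ i j, HasDerivWithinAt (fun s => L1 s i j)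
    ((-(p.check1RHS N (p.Theta (Λ₁ t)) (L1 t) (L2 t))) i j) (Icc (0 : ℝ) p.T) t) ∧
  (∀ t ∈ Icc (0 : ℝ) p.T, ∀ i j, HasDerivWithinAt (fun s => L2 s i j)
    ((-(p.check2RHS N (p.Theta (Λ₁ t)) (L1 t) (L2 t))) i j) (Icc (0 : ℝ) p.T) t)

/-- Solution of (ODE-Λ̌₁^N)–(ODE-Λ̌₂₂^N) on [0,T], with Θ, Θ₁, Z₀, Z₁ from the limiting (Λ₁, Λ₂). -/
noncomputable def IsSolCheckB (N : ℕ) (Λ₁ Λ₂ : ℝ → Matrix (Fin n) (Fin n) ℝ)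
    (L1 L2 L12 L22 : ℝ → Matrix (Fin n) (Fin n) ℝ) : Prop :=
  p.IsSolCheckA N Λ₁ L1 L2 ∧
  L12 p.T = 0 ∧ L22 p.T = 0 ∧
  (∀ t ∈ Icc (0 : ℝ) p.T, ∀ i j, HasDerivWithinAt (fun s => L12 s i j)
    ((-(p.check12RHS N (p.Theta (Λ₁ t)) (p.Theta1 (Λ₁ t) (Λ₂ t))
        (L1 t) (L2 t) (L12 t))) i j) (Icc (0 : ℝ) p.T) t) ∧
  (∀ t ∈ Icc (0 : ℝ) p.T, ∀ i j, HasDerivWithinAt (fun s => L22 s i j)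
    ((-(p.check22RHS N (p.Theta1 (Λ₁ t) (Λ₂ t)) (p.Z0 (Λ₁ t) (Λ₂ t))
        (p.Z1 (Λ₁ t) (Λ₂ t)) (L1 t) (L2 t) (L12 t) (L22 t))) i j) (Icc (0 : ℝ) p.T) t)

/-- Solution of the full decentralized coefficient system on [0,T],
with Θ, Θ₁, Θ₂, Z₀, Z₁ from the limiting (Λ₁, Λ₂, S). -/
noncomputable def IsSolCheckC (N : ℕ) (Λ₁ Λ₂ : ℝ → Matrix (Fin n) (Fin n) ℝ)
    (S : ℝ → Matrix (Fin n) (Fin 1) ℝ)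
    (L1 L2 L12 L22 : ℝ → Matrix (Fin n) (Fin n) ℝ)
    (S1 S2 : ℝ → Matrix (Fin n) (Fin 1) ℝ) : Prop :=
  p.IsSolCheckB N Λ₁ Λ₂ L1 L2 L12 L22 ∧
  S1 p.T = 0 ∧ S2 p.T = 0 ∧
  (∀ t ∈ Icc (0 : ℝ) p.T, ∀ i j, HasDerivWithinAt (fun s => S1 s i j)
    ((-(p.checkS1RHS N (p.Theta (Λ₁ t)) (p.Theta2 (Λ₁ t) (Λ₂ t) (S t))
        (L1 t) (L2 t) (L12 t) (S1 t))) i j) (Icc (0 : ℝ) p.T) t) ∧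
  (∀ t ∈ Icc (0 : ℝ) p.T, ∀ i j, HasDerivWithinAt (fun s => S2 s i j)
    ((-(p.checkS2RHS N (p.Theta1 (Λ₁ t) (Λ₂ t)) (p.Theta2 (Λ₁ t) (Λ₂ t) (S t))
        (p.Z0 (Λ₁ t) (Λ₂ t)) (p.Z1 (Λ₁ t) (Λ₂ t))
        (L1 t) (L2 t) (L12 t) (L22 t) (S1 t) (S2 t))) i j) (Icc (0 : ℝ) p.T) t)

end Params

/-! Block matrices with common diagonal and common off-diagonal blocks. -/

/-- `I_N ⊗ D + 𝟏_{N×N} ⊗ K`. -/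
def blockSum (N : ℕ) {a b : ℕ} (D K : Matrix (Fin a) (Fin b) ℝ) :
    Matrix (Fin N × Fin a) (Fin N × Fin b) ℝ :=
  Matrix.of fun x y => (if x.1 = y.1 then D x.2 y.2 else 0) + K x.2 y.2

section BlockAlgebra

variable {N a b c : ℕ}

lemma blockSum_add (D K D' K' : Matrix (Fin a) (Fin b) ℝ) :
    blockSum N D K + blockSum N D' K' = blockSum N (D + D') (K + K') := by
  ext x y
  by_cases h : x.1 = y.1 <;> simp [blockSum, h]
  ring

lemma blockSum_sub (D K D' K' : Matrix (Fin a) (Fin b) ℝ) :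
    blockSum N D K - blockSum N D' K' = blockSum N (D - D') (K - K') := by
  ext x y
  by_cases h : x.1 = y.1 <;> simp [blockSum, h]
  ring

lemma blockSum_smul (r : ℝ) (D K : Matrix (Fin a) (Fin b) ℝ) :
    r • blockSum N D K = blockSum N (r • D) (r • K) := by
  ext x y
  by_cases h : x.1 = y.1 <;> simp [blockSum, h, mul_add]

lemma blockSum_transpose (D K : Matrix (Fin a) (Fin b) ℝ) :
    (blockSum N D K)ᵀ = blockSum N Dᵀ Kᵀ := by
  ext x y
  simp [blockSum, eq_comm]

lemma blockSum_one : blockSum N (1 : Matrix (Fin a) (Fin a) ℝ) 0 = 1 := by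
  ext x y
  by_cases h : x.1 = y.1 <;> simp [blockSum, h, Matrix.one_apply, Prod.ext_iff]

lemma blockSum_mul (D K : Matrix (Fin a) (Fin b) ℝ) (D' K' : Matrix (Fin b) (Fin c) ℝ) :
    blockSum N D K * blockSum N D' K' =
      blockSum N (D * D') (D * K' + K * D' + (N : ℝ) • (K * K')) := by
  ext x y
  simp only [blockSum, Matrix.mul_apply, Matrix.of_apply, Fintype.sum_prod_type, Matrix.add_apply,
    Matrix.smul_apply, smul_eq_mul, add_mul, mul_add, ite_mul, mul_ite, zero_mul, mul_zero,
    Finset.sum_add_distrib, Finset.sum_const, Finset.card_univ, Fintype.card_fin, nsmul_eq_mul]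
  rw [Finset.sum_comm, Finset.sum_comm (s := (Finset.univ : Finset (Fin N)))]
  by_cases h : x.1 = y.1 <;> simp [h, Finset.mul_sum, Finset.sum_add_distrib]
  all_goals ring

lemma blockPN_eq_blockSum (Λ₁ Λ₂ : Matrix (Fin a) (Fin a) ℝ) :
    blockPN N a Λ₁ Λ₂ = blockSum N (Λ₁ - (1 / (N : ℝ)) • Λ₂) ((1 / (N : ℝ)) • Λ₂) := by
  ext x y
  by_cases h : x.1 = y.1 <;> simp [blockSum, blockPN, h]
  ring

/-- Inverse of `I_N ⊗ D + 𝟏_{N×N} ⊗ K` from the inverses on its two invariant subspaces. -/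
lemma blockSum_inv (hN : (N : ℝ) ≠ 0) (D K : Matrix (Fin a) (Fin a) ℝ)
    (hD : IsUnit D) (hS : IsUnit (D + (N : ℝ) • K)) :
    (blockSum N D K)⁻¹ =
      blockSum N D⁻¹ ((1 / (N : ℝ)) • ((D + (N : ℝ) • K)⁻¹ - D⁻¹)) := by
  apply Matrix.inv_eq_right_inv
  have h1 : D * D⁻¹ = 1 := Matrix.mul_nonsing_inv _ ((Matrix.isUnit_iff_isUnit_det _).1 hD)
  have h2 : (D + (N : ℝ) • K) * (D + (N : ℝ) • K)⁻¹ = 1 :=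
    Matrix.mul_nonsing_inv _ ((Matrix.isUnit_iff_isUnit_det _).1 hS)
  rw [blockSum_mul, h1, ← blockSum_one]
  congr 1
  generalize (D + (N : ℝ) • K)⁻¹ = V at *
  have h3 : D * V + (N : ℝ) • (K * V) = 1 := by rw [← h2, add_mul, smul_mul_assoc]
  have h4 : D * V = 1 - (N : ℝ) • (K * V) := eq_sub_of_add_eq h3
  simp only [mul_smul_comm, mul_sub, h1, h4]
  match_scalars <;> field_simp <;> ring

/-- Positive semidefiniteness passes to the two invariant subspaces. -/
lemma blockSum_posSemidef (hN : 2 ≤ N) (D K : Matrix (Fin a) (Fin a) ℝ)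
    (h : (blockSum N D K).PosSemidef) : D.PosSemidef ∧ (D + (N : ℝ) • K).PosSemidef := by
  have hN0 : (N : ℝ) ≠ 0 := by positivity
  constructor
  · let i0 : Fin N := ⟨0, by omega⟩
    let i1 : Fin N := ⟨1, by omega⟩
    have h01 : i0 ≠ i1 := by simp [i0, i1]
    let U : Matrix (Fin N × Fin a) (Fin a) ℝ := Matrix.of fun x k =>
      ((if x.1 = i0 then 1 else 0) - (if x.1 = i1 then 1 else 0)) * (1 : Matrix _ _ ℝ) x.2 k
    have h1 := (h.conjTranspose_mul_mul_same U).smul (show (0 : ℝ) ≤ 1 / 2 by norm_num)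
    convert h1 using 1
    ext k l
    simp [U, blockSum, Matrix.mul_apply, Fintype.sum_prod_type, Matrix.one_apply, sub_mul, mul_sub,
      Finset.sum_add_distrib, Finset.sum_sub_distrib, mul_add, h01, h01.symm]
    try ring
  · have h1 := (h.conjTranspose_mul_mul_same (stackN N (1 : Matrix (Fin a) (Fin a) ℝ))).smul
      (show (0 : ℝ) ≤ 1 / N by positivity)
    convert h1 using 1
    ext k l
    simp [stackN, blockSum, Matrix.mul_apply, Fintype.sum_prod_type, Matrix.one_apply,
      Finset.sum_add_distrib]
    field_simp

end BlockAlgebra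

namespace Params

variable {n n₁ : ℕ} (p : Params n n₁)

lemma bigA_eq (N : ℕ) : p.bigA N = blockSum N p.A ((1 / (N : ℝ)) • p.G) := by
  ext x y
  simp [bigA, blockSum, div_eq_inv_mul]

lemma bigQ_eq (N : ℕ) : p.bigQ N = blockSum N p.Q ((1 / (N : ℝ)) • p.QΓ) := by
  ext x y
  simp [bigQ, blockSum, div_eq_inv_mul]

lemma bigBhat_eq (N : ℕ) : p.bigBhat N = blockSum N p.B 0 := by
  ext x y
  simp [bigBhat, blockSum]

lemma bigR_eq (N : ℕ) : p.bigR N = blockSum N p.R 0 := by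
  ext x y
  simp [bigR, blockSum]

lemma bigB0_mul_bigIhat (N : ℕ) :
    p.bigB0 N * p.bigIhat N = blockSum N 0 ((1 / (N : ℝ)) • p.B0) := by
  ext x y
  simp [bigB0, bigIhat, blockSum, Matrix.mul_apply, div_eq_inv_mul]

lemma sum_bigB_conj (N : ℕ) (D K : Matrix (Fin n) (Fin n) ℝ) :
    ∑ i : Fin N, (p.bigE N i)ᵀ * (p.bigB N i)ᵀ * blockSum N D K * p.bigB N i * p.bigE N i
      = blockSum N (p.B1ᵀ * (D + K) * p.B1) 0 := by
  have hU : ∀ i : Fin N, p.bigB N i * p.bigE N i =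
      Matrix.of fun x y => if y.1 = i then (if x.1 = i then p.B1 x.2 y.2 else 0) else 0 := by
    intro i
    ext x y
    by_cases h : y.1 = i <;> simp [bigB, bigE, Matrix.mul_apply, h]
  have hc : ∀ i : Fin N,
      (p.bigE N i)ᵀ * (p.bigB N i)ᵀ * blockSum N D K * p.bigB N i * p.bigE N i
      = (p.bigB N i * p.bigE N i)ᵀ * blockSum N D K * (p.bigB N i * p.bigE N i) := by
    intro i
    rw [Matrix.transpose_mul]
    simp only [Matrix.mul_assoc]
  simp only [hc, hU]
  ext x y
  simp only [Matrix.sum_apply, Matrix.mul_apply, Matrix.transpose_apply, Matrix.of_apply,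
    Fintype.sum_prod_type, blockSum, Matrix.add_apply, Matrix.zero_apply, add_zero]
  simp only [ite_mul, mul_ite, zero_mul, mul_zero, Finset.sum_ite_irrel, Finset.sum_const_zero,
    Finset.sum_ite_eq, Finset.sum_ite_eq', Finset.mem_univ, if_true]

/-- Block form of `𝐑 + 2𝓜₂(𝐏)`. -/
lemma bigR_add_M2_blockPN {N : ℕ} (hN : (N : ℝ) ≠ 0) (Λ₁ Λ₂ : Matrix (Fin n) (Fin n) ℝ) :
    p.bigR N + (2 : ℝ) • p.M2 N (blockPN N n Λ₁ Λ₂) =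
      blockSum N (p.R1 Λ₁)
        ((1 / (N : ℝ)) • (p.B0ᵀ * (Λ₁ + (1 - 1 / (N : ℝ)) • Λ₂) * p.B0)) := by
  have h2 : (p.bigIhat N)ᵀ * (p.bigB0 N)ᵀ * blockPN N n Λ₁ Λ₂ * p.bigB0 N * p.bigIhat N
      = (p.bigB0 N * p.bigIhat N)ᵀ * blockPN N n Λ₁ Λ₂ * (p.bigB0 N * p.bigIhat N) := by
    rw [Matrix.transpose_mul]
    simp only [Matrix.mul_assoc]
  rw [M2, h2, bigB0_mul_bigIhat, blockPN_eq_blockSum, sum_bigB_conj, bigR_eq, blockSum_transpose]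
  simp only [blockSum_mul, blockSum_smul, blockSum_add]
  congr 1
  · simp [R1]
  · simp only [Matrix.transpose_zero, Matrix.zero_mul, Matrix.mul_zero, Matrix.transpose_smul,
      Matrix.smul_mul, Matrix.mul_smul, Matrix.mul_add, Matrix.add_mul, Matrix.mul_sub,
      Matrix.sub_mul, zero_add, smul_zero]
    match_scalars <;> field_simp
    ring

lemma R1_add_smul {N : ℕ} (hN : (N : ℝ) ≠ 0) (Λ₁ Λ₂ : Matrix (Fin n) (Fin n) ℝ) :
    p.R1 Λ₁ + (N : ℝ) • ((1 / (N : ℝ)) • (p.B0ᵀ * (Λ₁ + (1 - 1 / (N : ℝ)) • Λ₂) * p.B0)) =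
      p.R2 Λ₁ Λ₂ - (1 / (N : ℝ)) • (p.B0ᵀ * Λ₂ * p.B0) := by
  simp only [R1, R2, Matrix.smul_mul, Matrix.mul_smul, Matrix.mul_add, Matrix.add_mul]
  match_scalars <;> field_simp

/-- The Riccati vector field on block matrices is the rescaled vector field. -/
lemma PRic_blockPN {N : ℕ} (hN : (N : ℝ) ≠ 0) (Λ₁ Λ₂ : Matrix (Fin n) (Fin n) ℝ)
    (h1 : IsUnit (p.R1 Λ₁))
    (h2 : IsUnit (p.R2 Λ₁ Λ₂ - (1 / (N : ℝ)) • (p.B0ᵀ * Λ₂ * p.B0))) :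
    p.PRic N (blockPN N n Λ₁ Λ₂) =
      blockPN N n (p.Ψ₁ Λ₁ + p.g₁ N Λ₁ Λ₂) (p.Ψ₂ Λ₁ Λ₂ + p.g₂ N Λ₁ Λ₂) := by
  rw [PRic, p.bigR_add_M2_blockPN hN, blockSum_inv hN _ _ h1 (by rwa [p.R1_add_smul hN]),
    p.R1_add_smul hN, ← EN]
  simp only [blockPN_eq_blockSum, bigA_eq, bigBhat_eq, bigQ_eq, blockSum_transpose, blockSum_mul,
    blockSum_sub]
  congr 1 <;>
  · simp only [Ψ₁, Ψ₂, g₁, g₂, HN, Matrix.transpose_zero, Matrix.mul_zero,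
      Matrix.transpose_smul, Matrix.smul_mul, Matrix.mul_smul, Matrix.mul_add, Matrix.add_mul,
      Matrix.mul_sub, Matrix.sub_mul, zero_add, add_zero, smul_zero, Matrix.mul_assoc]
    match_scalars <;> field_simp <;> ring

end Params

section EntrywiseNorm

variable {a b c : Type*} [Fintype a] [Fintype b] [Fintype c]

lemma l1norm_nonneg (M : Matrix a b ℝ) : 0 ≤ l1norm M :=
  Finset.sum_nonneg fun _ _ => Finset.sum_nonneg fun _ _ => abs_nonneg _

lemma abs_le_l1norm (M : Matrix a b ℝ) (i : a) (j : b) : |M i j| ≤ l1norm M :=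
  (Finset.single_le_sum (f := fun j => |M i j|) (fun _ _ => abs_nonneg _)
    (Finset.mem_univ j)).trans
    (Finset.single_le_sum (f := fun i => ∑ j, |M i j|)
      (fun _ _ => Finset.sum_nonneg fun _ _ => abs_nonneg _) (Finset.mem_univ i))

lemma l1norm_add_le (M M' : Matrix a b ℝ) : l1norm (M + M') ≤ l1norm M + l1norm M' := by
  simp only [l1norm, ← Finset.sum_add_distrib, Matrix.add_apply]
  gcongr
  exact abs_add_le _ _

lemma l1norm_neg (M : Matrix a b ℝ) : l1norm (-M) = l1norm M := by
  simp [l1norm]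

lemma l1norm_sub_le (M M' : Matrix a b ℝ) : l1norm (M - M') ≤ l1norm M + l1norm M' := by
  rw [sub_eq_add_neg, ← l1norm_neg M']
  exact l1norm_add_le _ _

lemma l1norm_smul (r : ℝ) (M : Matrix a b ℝ) : l1norm (r • M) = |r| * l1norm M := by
  simp [l1norm, abs_mul, Finset.mul_sum]

lemma l1norm_sum_le {ι : Type*} (s : Finset ι) (M : ι → Matrix a b ℝ) :
    l1norm (∑ i ∈ s, M i) ≤ ∑ i ∈ s, l1norm (M i) :=
  Finset.le_sum_of_subadditive _ (by simp [l1norm]) l1norm_add_le _ _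

lemma l1norm_mul_le (M : Matrix a b ℝ) (M' : Matrix b c ℝ) :
    l1norm (M * M') ≤ l1norm M * l1norm M' := by
  calc l1norm (M * M') ≤ ∑ i, ∑ k, ∑ j, |M i j| * |M' j k| := by
        simp only [l1norm, Matrix.mul_apply, ← abs_mul]
        gcongr
        exact Finset.abs_sum_le_sum_abs _ _
    _ = ∑ i, ∑ j, |M i j| * ∑ k, |M' j k| := by
        simp only [Finset.mul_sum]
        exact Finset.sum_congr rfl fun i _ => Finset.sum_comm
    _ ≤ ∑ i, ∑ j, |M i j| * l1norm M' := by
        gcongr with i _ j _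
        exact Finset.single_le_sum (f := fun i => ∑ j, |M' i j|)
          (fun _ _ => Finset.sum_nonneg fun _ _ => abs_nonneg _) (Finset.mem_univ j)
    _ = l1norm M * l1norm M' := by simp only [l1norm, Finset.sum_mul]

lemma l1norm_mul_mul_le {d : Type*} [Fintype d] (U : Matrix a b ℝ) (Z : Matrix b c ℝ)
    (V : Matrix c d ℝ) : l1norm (U * Z * V) ≤ l1norm U * l1norm Z * l1norm V :=
  (l1norm_mul_le _ _).trans
    (mul_le_mul_of_nonneg_right (l1norm_mul_le _ _) (l1norm_nonneg _))

lemma frob_le_l1norm (M : Matrix a b ℝ) : frob M ≤ l1norm M := by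
  refine Real.sqrt_le_iff.2 ⟨l1norm_nonneg M, ?_⟩
  calc ∑ i, ∑ j, M i j ^ 2 ≤ ∑ i, ∑ j, |M i j| * l1norm M := by
        gcongr with i _ j _
        rw [← sq_abs, sq]
        exact mul_le_mul_of_nonneg_left (abs_le_l1norm M i j) (abs_nonneg _)
    _ = l1norm M ^ 2 := by simp only [sq, l1norm, Finset.sum_mul]

/-- Symmetric matrices are bounded below by minus their entrywise norm. -/
lemma posSemidef_l1norm_smul_one_add [DecidableEq a] (M : Matrix a a ℝ) (hM : M.IsSymm) :
    (l1norm M • (1 : Matrix a a ℝ) + M).PosSemidef := by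
  refine Matrix.posSemidef_iff_dotProduct_mulVec.2 ⟨?_, fun x => ?_⟩
  · simp [Matrix.IsHermitian, Matrix.conjTranspose_eq_transpose_of_trivial, hM.eq]
  · have key : -(x ⬝ᵥ M *ᵥ x) ≤ l1norm M * (x ⬝ᵥ x) := by
      calc -(x ⬝ᵥ M *ᵥ x) = ∑ i, ∑ j, -(x i * (M i j * x j)) := by
            simp [dotProduct, Matrix.mulVec, Finset.mul_sum]
        _ ≤ ∑ i, ∑ j, |M i j| * (x ⬝ᵥ x) := by
            gcongr with i _ j _
            have hle : ∀ k, x k * x k ≤ x ⬝ᵥ x := fun k =>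
              Finset.single_le_sum (f := fun k => x k * x k)
                (fun _ _ => mul_self_nonneg _) (Finset.mem_univ k)
            have hx : |x i| * |x j| ≤ x ⬝ᵥ x := by
              have h1 := hle i
              have h2 := hle j
              rw [← abs_mul_abs_self] at h1 h2
              nlinarith [sq_nonneg (|x i| - |x j|)]
            calc -(x i * (M i j * x j)) ≤ |x i * (M i j * x j)| := neg_le_abs _
              _ = |M i j| * (|x i| * |x j|) := by rw [abs_mul, abs_mul]; ring
              _ ≤ _ := by gcongr
        _ = l1norm M * (x ⬝ᵥ x) := by simp only [l1norm, Finset.sum_mul]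
    simp only [star_trivial, Matrix.add_mulVec, Matrix.smul_mulVec, Matrix.one_mulVec,
      dotProduct_add, dotProduct_smul, smul_eq_mul]
    linarith

end EntrywiseNorm

lemma exists_l1norm_le_of_continuousOn {a b : Type*} [Fintype a] [Fintype b]
    {F : ℝ → Matrix a b ℝ} {s : Set ℝ} (hs : IsCompact s) (hF : ContinuousOn F s) :
    ∃ c, 0 ≤ c ∧ ∀ t ∈ s, l1norm (F t) ≤ c := by
  have hl : Continuous (l1norm : Matrix a b ℝ → ℝ) := by
    unfold l1norm
    fun_prop
  obtain ⟨c, hc⟩ := hs.exists_bound_of_continuousOn (hl.comp_continuousOn hF)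
  refine ⟨max c 0, le_max_right _ _, fun t ht => ?_⟩
  exact (le_abs_self _).trans ((hc t ht).trans (le_max_left _ _))

lemma continuousOn_matrix_inv {a : Type*} [Fintype a] [DecidableEq a]
    {F : ℝ → Matrix a a ℝ} {s : Set ℝ} (hF : ContinuousOn F s) (hu : ∀ t ∈ s, IsUnit (F t)) :
    ContinuousOn (fun t => (F t)⁻¹) s := by
  rw [continuousOn_iff_continuous_domRestrict] at hF ⊢
  have hd : ∀ t : s, (F t).det ≠ 0 := fun t =>
    ((Matrix.isUnit_iff_isUnit_det _).1 (hu t t.2)).ne_zero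
  have : Continuous fun t : s => ((F t).det)⁻¹ • (F t).adjugate :=
    (hF.matrix_det.inv₀ hd).smul hF.matrix_adjugate
  refine this.congr fun t => ?_
  simp [Matrix.inv_def]

namespace Params

variable {n n₁ : ℕ} (p : Params n n₁)

lemma continuous_M2 (N : ℕ) : Continuous (p.M2 N) := by
  unfold M2
  fun_prop

lemma M2_sub (N : ℕ) (Z Z' : Matrix (Fin N × Fin n) (Fin N × Fin n) ℝ) :
    p.M2 N (Z - Z') = p.M2 N Z - p.M2 N Z' := by
  simp only [M2, Matrix.mul_sub, Matrix.sub_mul, Finset.sum_sub_distrib, smul_sub]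
  abel

lemma exists_l1norm_M2_le (N : ℕ) :
    ∃ m, 0 ≤ m ∧ ∀ Z, l1norm (p.M2 N Z) ≤ m * l1norm Z := by
  refine ⟨|1 / 2| * (∑ i : Fin N, l1norm ((p.bigE N i)ᵀ * (p.bigB N i)ᵀ) *
    l1norm (p.bigB N i * p.bigE N i)) + |1 / 2| *
    (l1norm ((p.bigIhat N)ᵀ * (p.bigB0 N)ᵀ) * l1norm (p.bigB0 N * p.bigIhat N)), ?_, fun Z => ?_⟩
  · exact add_nonneg
      (mul_nonneg (abs_nonneg _) (Finset.sum_nonneg fun i _ =>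
        mul_nonneg (l1norm_nonneg _) (l1norm_nonneg _)))
      (mul_nonneg (abs_nonneg _) (mul_nonneg (l1norm_nonneg _) (l1norm_nonneg _)))
  · rw [M2, add_mul, mul_assoc, mul_assoc, Finset.sum_mul]
    refine (l1norm_add_le _ _).trans ?_
    rw [l1norm_smul, l1norm_smul]
    gcongr
    · refine (l1norm_sum_le _ _).trans ?_
      gcongr with i _
      rw [Matrix.mul_assoc]
      exact (l1norm_mul_mul_le _ _ _).trans (by rw [mul_right_comm])
    · rw [Matrix.mul_assoc]
      exact (l1norm_mul_mul_le _ _ _).trans (by rw [mul_right_comm])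

lemma PRic_sub (N : ℕ) {Z Z' : Matrix (Fin N × Fin n) (Fin N × Fin n) ℝ}
    (hu : IsUnit (p.bigR N + (2 : ℝ) • p.M2 N Z)) (hu' : IsUnit (p.bigR N + (2 : ℝ) • p.M2 N Z')) :
    p.PRic N Z - p.PRic N Z' =
      (Z - Z') * (p.bigBhat N * (p.bigR N + (2 : ℝ) • p.M2 N Z)⁻¹ * (p.bigBhat N)ᵀ) * Z
      - Z' * (p.bigBhat N * ((p.bigR N + (2 : ℝ) • p.M2 N Z)⁻¹ * ((2 : ℝ) • p.M2 N (Z - Z')) *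
          (p.bigR N + (2 : ℝ) • p.M2 N Z')⁻¹) * (p.bigBhat N)ᵀ) * Z
      + Z' * (p.bigBhat N * (p.bigR N + (2 : ℝ) • p.M2 N Z')⁻¹ * (p.bigBhat N)ᵀ) * (Z - Z')
      - (Z - Z') * p.bigA N - (p.bigA N)ᵀ * (Z - Z') := by
  have hW : (2 : ℝ) • p.M2 N (Z - Z') =
      (p.bigR N + (2 : ℝ) • p.M2 N Z) - (p.bigR N + (2 : ℝ) • p.M2 N Z') := by
    rw [M2_sub, smul_sub]
    abel
  rw [hW, PRic, PRic]
  generalize p.bigR N + (2 : ℝ) • p.M2 N Z = W at *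
  generalize p.bigR N + (2 : ℝ) • p.M2 N Z' = W' at *
  have h1 : W⁻¹ * (W - W') * W'⁻¹ = W'⁻¹ - W⁻¹ := by
    rw [Matrix.mul_sub, Matrix.sub_mul,
      Matrix.nonsing_inv_mul _ ((Matrix.isUnit_iff_isUnit_det _).1 hu), Matrix.mul_assoc,
      Matrix.mul_nonsing_inv _ ((Matrix.isUnit_iff_isUnit_det _).1 hu'), Matrix.one_mul,
      Matrix.mul_one]
  rw [h1]
  simp only [Matrix.mul_sub, Matrix.sub_mul, Matrix.mul_assoc]
  abel

lemma exists_PRic_lipschitz (N : ℕ) (z s : ℝ) (hz : 0 ≤ z) (hs : 0 ≤ s) :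
    ∃ K, 0 ≤ K ∧ ∀ Z Z' : Matrix (Fin N × Fin n) (Fin N × Fin n) ℝ,
      IsUnit (p.bigR N + (2 : ℝ) • p.M2 N Z) → IsUnit (p.bigR N + (2 : ℝ) • p.M2 N Z') →
      l1norm Z ≤ z → l1norm Z' ≤ z →
      l1norm (p.bigR N + (2 : ℝ) • p.M2 N Z)⁻¹ ≤ s →
      l1norm (p.bigR N + (2 : ℝ) • p.M2 N Z')⁻¹ ≤ s →
      l1norm (p.PRic N Z - p.PRic N Z') ≤ K * l1norm (Z - Z') := by
  obtain ⟨m, hm, hM⟩ := p.exists_l1norm_M2_le N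
  set b := l1norm (p.bigBhat N)
  set b' := l1norm (p.bigBhat N)ᵀ
  set α := l1norm (p.bigA N)
  set α' := l1norm (p.bigA N)ᵀ
  have hb0 : 0 ≤ b := l1norm_nonneg _
  have hb0' : 0 ≤ b' := l1norm_nonneg _
  have hα0 : 0 ≤ α := l1norm_nonneg _
  have hα0' : 0 ≤ α' := l1norm_nonneg _
  refine ⟨b * s * b' * z + z * (b * (s * (2 * m) * s) * b') * z + z * (b * s * b') + α + α',
    by positivity, fun Z Z' hu hu' hZ hZ' hS hS' => ?_⟩
  rw [p.PRic_sub N hu hu']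
  set S := (p.bigR N + (2 : ℝ) • p.M2 N Z)⁻¹
  set S' := (p.bigR N + (2 : ℝ) • p.M2 N Z')⁻¹
  set δ := l1norm (Z - Z')
  have hδ : 0 ≤ δ := l1norm_nonneg _
  have n1 := l1norm_nonneg Z
  have n2 := l1norm_nonneg Z'
  have n3 := l1norm_nonneg S
  have n4 := l1norm_nonneg S'
  have hBS : l1norm (p.bigBhat N * S * (p.bigBhat N)ᵀ) ≤ b * s * b' :=
    (l1norm_mul_mul_le _ _ _).trans (by gcongr)
  have hBS' : l1norm (p.bigBhat N * S' * (p.bigBhat N)ᵀ) ≤ b * s * b' :=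
    (l1norm_mul_mul_le _ _ _).trans (by gcongr)
  have h2M : l1norm ((2 : ℝ) • p.M2 N (Z - Z')) ≤ 2 * m * δ := by
    rw [l1norm_smul, abs_two, mul_assoc]
    gcongr
    exact hM _
  have hSMS : l1norm (S * ((2 : ℝ) • p.M2 N (Z - Z')) * S') ≤ s * (2 * m * δ) * s := by
    refine (l1norm_mul_mul_le _ _ _).trans ?_
    have := l1norm_nonneg ((2 : ℝ) • p.M2 N (Z - Z'))
    gcongr
  have t1 : l1norm ((Z - Z') * (p.bigBhat N * S * (p.bigBhat N)ᵀ) * Z) ≤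
      δ * (b * s * b') * z := by
    refine (l1norm_mul_mul_le _ _ _).trans ?_
    have := l1norm_nonneg (p.bigBhat N * S * (p.bigBhat N)ᵀ)
    gcongr
  have t2 : l1norm (Z' * (p.bigBhat N * (S * ((2 : ℝ) • p.M2 N (Z - Z')) * S') *
      (p.bigBhat N)ᵀ) * Z) ≤ z * (b * (s * (2 * m * δ) * s) * b') * z := by
    refine (l1norm_mul_mul_le _ _ _).trans ?_
    have h1 : l1norm (p.bigBhat N * (S * ((2 : ℝ) • p.M2 N (Z - Z')) * S') * (p.bigBhat N)ᵀ) ≤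
      b * (s * (2 * m * δ) * s) * b' := (l1norm_mul_mul_le _ _ _).trans (by gcongr)
    have := l1norm_nonneg
      (p.bigBhat N * (S * ((2 : ℝ) • p.M2 N (Z - Z')) * S') * (p.bigBhat N)ᵀ)
    gcongr
  have t3 : l1norm (Z' * (p.bigBhat N * S' * (p.bigBhat N)ᵀ) * (Z - Z')) ≤
      z * (b * s * b') * δ := by
    refine (l1norm_mul_mul_le _ _ _).trans ?_
    have := l1norm_nonneg (p.bigBhat N * S' * (p.bigBhat N)ᵀ)
    gcongr
  have t4 : l1norm ((Z - Z') * p.bigA N) ≤ δ * α := l1norm_mul_le _ _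
  have t5 : l1norm ((p.bigA N)ᵀ * (Z - Z')) ≤ α' * δ := l1norm_mul_le _ _
  refine (l1norm_sub_le _ _).trans ?_
  refine (add_le_add_left (l1norm_sub_le _ _) _).trans ?_
  refine (add_le_add_left (add_le_add_left (l1norm_add_le _ _) _) _).trans ?_
  refine (add_le_add_left (add_le_add_left (add_le_add_left (l1norm_sub_le _ _) _) _) _).trans ?_
  linarith

section Uniqueness

variable {p} {N : ℕ} {P P' : ℝ → Matrix (Fin N × Fin n) (Fin N × Fin n) ℝ}

lemma IsSolP.continuousOn (h : p.IsSolP N P) : ContinuousOn P (Icc 0 p.T) :=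
  continuousOn_pi.2 fun x => continuousOn_pi.2 fun y => fun t ht =>
    (h.2.2.2 t ht x y).continuousWithinAt

lemma IsSolP.exists_bounds (h : p.IsSolP N P) :
    ∃ c, 0 ≤ c ∧ ∀ t ∈ Icc 0 p.T, l1norm (P t) ≤ c ∧
      l1norm (p.bigR N + (2 : ℝ) • p.M2 N (P t))⁻¹ ≤ c := by
  obtain ⟨c, hc, hP⟩ := exists_l1norm_le_of_continuousOn isCompact_Icc h.continuousOn
  have hW : ContinuousOn (fun t => p.bigR N + (2 : ℝ) • p.M2 N (P t)) (Icc 0 p.T) :=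
    (continuous_const.add ((p.continuous_M2 N).const_smul (2 : ℝ))).comp_continuousOn h.continuousOn
  obtain ⟨c', hc', hS⟩ := exists_l1norm_le_of_continuousOn isCompact_Icc
    (continuousOn_matrix_inv hW fun t ht => (h.2.1 t ht).isUnit)
  exact ⟨max c c', le_max_of_le_left hc, fun t ht =>
    ⟨(hP t ht).trans (le_max_left _ _), (hS t ht).trans (le_max_right _ _)⟩⟩

/-- Solutions of (ODE-P) are unique. -/
lemma IsSolP.eqOn (h : p.IsSolP N P) (h' : p.IsSolP N P') : EqOn P P' (Icc 0 p.T) := by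
  obtain ⟨c, hc, hb⟩ := h.exists_bounds
  obtain ⟨c', hc', hb'⟩ := h'.exists_bounds
  obtain ⟨K, hK, hL⟩ := p.exists_PRic_lipschitz N (max c c') (max c c')
    (le_max_of_le_left hc) (le_max_of_le_left hc)
  let E := Fin N × Fin n → Fin N × Fin n → ℝ
  let v : E → E := p.PRic N
  let M : ℝ := Fintype.card (Fin N × Fin n) * Fintype.card (Fin N × Fin n)
  have hM : ∀ f g : E, l1norm (Matrix.of f - Matrix.of g) ≤ M * dist f g := by
    intro f g
    calc l1norm (Matrix.of f - Matrix.of g) ≤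
        ∑ _i : Fin N × Fin n, ∑ _j : Fin N × Fin n, dist f g := by
          unfold l1norm
          gcongr with i _ j _
          exact (dist_le_pi_dist (f i) (g i) j).trans (dist_le_pi_dist f g i)
      _ = M * dist f g := by
          simp only [Finset.sum_const, Finset.card_univ, nsmul_eq_mul, M]
          ring
  have hM0 : 0 ≤ M := by positivity
  have hdist : ∀ f g : E, l1norm (Matrix.of (v f) - Matrix.of (v g)) ≤
      K * l1norm (Matrix.of f - Matrix.of g) → dist (v f) (v g) ≤ K * M * dist f g := by
    intro f g hfg
    have h0 : 0 ≤ K * M * dist f g := by positivity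
    refine (dist_pi_le_iff h0).2 fun i => (dist_pi_le_iff h0).2 fun j => ?_
    refine (abs_le_l1norm (Matrix.of (v f) - Matrix.of (v g)) i j).trans (hfg.trans ?_)
    rw [mul_assoc]
    exact mul_le_mul_of_nonneg_left (hM f g) hK
  have hd : ∀ {F : ℝ → Matrix (Fin N × Fin n) (Fin N × Fin n) ℝ}, p.IsSolP N F →
      ∀ t ∈ Ioc 0 p.T, HasDerivWithinAt (fun s => (F s : E)) (v (F t)) (Iic t) t := by
    intro F hF t ht
    refine hasDerivWithinAt_pi.2 fun x => hasDerivWithinAt_pi.2 fun y => ?_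
    refine (hF.2.2.2 t ⟨ht.1.le, ht.2⟩ x y).mono_of_mem_nhdsWithin ?_
    exact Filter.mem_of_superset (Icc_mem_nhdsLE ht.1) (Icc_subset_Icc_right ht.2)
  refine ODE_solution_unique_of_mem_Icc_left (E := E) (v := fun _ => v)
    (s := fun t => {(P t : E), (P' t : E)}) (K := ⟨K * M, by positivity⟩) ?_ h.continuousOn (hd h)
    (fun t _ => Or.inl rfl) h'.continuousOn (hd h') (fun t _ => Or.inr rfl)
    (h.2.2.1.trans h'.2.2.1.symm)
  intro t ht
  have ht' : t ∈ Icc 0 p.T := ⟨ht.1.le, ht.2⟩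
  refine LipschitzOnWith.of_dist_le_mul fun f hf g hg => hdist f g ?_
  have hu := (h.2.1 t ht').isUnit
  have hu' := (h'.2.1 t ht').isUnit
  have hP := (hb t ht').1.trans (le_max_left c c')
  have hP' := (hb' t ht').1.trans (le_max_right c c')
  have hS := (hb t ht').2.trans (le_max_left c c')
  have hS' := (hb' t ht').2.trans (le_max_right c c')
  rcases hf with rfl | rfl <;> rcases hg with rfl | rfl
  · exact hL _ _ hu hu hP hP hS hS
  · exact hL _ _ hu hu' hP hP' hS hS'
  · exact hL _ _ hu' hu hP' hP hS' hS
  · exact hL _ _ hu' hu' hP' hP' hS' hS'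

end Uniqueness

end Params

section BlockPN

variable {N n : ℕ} {Λ₁ Λ₂ : Matrix (Fin n) (Fin n) ℝ}

lemma l1norm_blockPN (hN : (N : ℝ) ≠ 0) :
    l1norm (blockPN N n Λ₁ Λ₂) / (N : ℝ) = l1norm Λ₁ + (1 - 1 / (N : ℝ)) * l1norm Λ₂ := by
  have h : ∀ x y, |blockPN N n Λ₁ Λ₂ x y| =
      (if x.1 = y.1 then |Λ₁ x.2 y.2| - |Λ₂ x.2 y.2| / N else 0) + |Λ₂ x.2 y.2| / N := by
    intro x y
    by_cases h : x.1 = y.1 <;> simp [blockPN, h, abs_div]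
  simp only [l1norm, h, Fintype.sum_prod_type, Finset.sum_add_distrib, Finset.sum_const,
    Finset.card_univ, Fintype.card_fin, nsmul_eq_mul]
  have h2 : ∀ i : Fin N, ∀ a : Fin n,
      (∑ j : Fin N, ∑ b, if i = j then |Λ₁ a b| - |Λ₂ a b| / N else 0) =
        ∑ b, (|Λ₁ a b| - |Λ₂ a b| / N) := by
    intro i a
    rw [Finset.sum_comm]
    simp
  simp only [h2, Finset.sum_const, Finset.card_univ, Fintype.card_fin, nsmul_eq_mul,
    Finset.sum_sub_distrib, ← Finset.sum_div, ← Finset.mul_sum]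
  field_simp
  ring

lemma l1norm_le_of_l1norm_blockPN_le (hN : 2 ≤ N) {C : ℝ}
    (h : l1norm (blockPN N n Λ₁ Λ₂) / (N : ℝ) ≤ C) :
    l1norm Λ₁ ≤ C ∧ l1norm Λ₂ ≤ 2 * C := by
  have hN2 : (2 : ℝ) ≤ N := by exact_mod_cast hN
  rw [l1norm_blockPN (by positivity)] at h
  have hi : 1 / (N : ℝ) ≤ 1 / 2 := one_div_le_one_div_of_le two_pos hN2
  have h1 := l1norm_nonneg Λ₁
  have h2 := l1norm_nonneg Λ₂
  constructor <;> nlinarith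

lemma blockPN_apply_same (i : Fin N) (a b : Fin n) :
    blockPN N n Λ₁ Λ₂ (i, a) (i, b) = Λ₁ a b := by
  simp [blockPN]

lemma blockPN_apply_ne {i j : Fin N} (hij : i ≠ j) (a b : Fin n) :
    blockPN N n Λ₁ Λ₂ (i, a) (j, b) = Λ₂ a b / N := by
  simp [blockPN, hij]

end BlockPN

namespace Params

variable {n n₁ : ℕ} {p : Params n n₁} {N : ℕ}

/-- Uniform positivity of `𝐑 + 2𝓜₂(𝐏)` passes to its blocks. -/
lemma posSemidef_R1_and_R2_of_blockPN (hN : 2 ≤ N) {Λ₁ Λ₂ : Matrix (Fin n) (Fin n) ℝ} {c : ℝ}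
    (h : (p.bigR N + (2 : ℝ) • p.M2 N (blockPN N n Λ₁ Λ₂) - c • 1).PosSemidef) :
    (p.R1 Λ₁ - c • 1).PosSemidef ∧
      (p.R2 Λ₁ Λ₂ - (1 / (N : ℝ)) • (p.B0ᵀ * Λ₂ * p.B0) - c • 1).PosSemidef := by
  have hN0 : (N : ℝ) ≠ 0 := by positivity
  rw [p.bigR_add_M2_blockPN hN0, ← blockSum_one, blockSum_smul, blockSum_sub, smul_zero,
    sub_zero] at h
  obtain ⟨h1, h2⟩ := blockSum_posSemidef hN _ _ h
  rw [sub_add_eq_add_sub, p.R1_add_smul hN0] at h2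
  exact ⟨h1, h2⟩

lemma posDef_of_posSemidef_sub {m : Type*} [Finite m] [DecidableEq m] {M : Matrix m m ℝ} {c : ℝ}
    (hc : 0 < c) (h : (M - c • 1).PosSemidef) : M.PosDef := by
  have := (Matrix.PosDef.one (n := m) (R := ℝ)).smul hc
  simpa using this.posSemidef_add h

lemma posSemidef_R2_sub (Λ₁ Λ₂ : Matrix (Fin n) (Fin n) ℝ) (hΛ : Λ₂.IsSymm) {c β : ℝ}
    (h : (p.R2 Λ₁ Λ₂ - (1 / (N : ℝ)) • (p.B0ᵀ * Λ₂ * p.B0) - c • 1).PosSemidef)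
    (hβ : 1 / (N : ℝ) * l1norm (p.B0ᵀ * Λ₂ * p.B0) ≤ β) :
    (p.R2 Λ₁ Λ₂ - (c - β) • 1).PosSemidef := by
  have hX : ((1 / (N : ℝ)) • (p.B0ᵀ * Λ₂ * p.B0)).IsSymm := by
    simp [Matrix.IsSymm, Matrix.transpose_mul, hΛ.eq, Matrix.mul_assoc]
  have h1 := posSemidef_l1norm_smul_one_add _ hX
  rw [l1norm_smul, abs_of_nonneg (by positivity)] at h1
  have h2 := (Matrix.PosSemidef.one (n := Fin n₁) (R := ℝ)).smul (sub_nonneg.2 hβ)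
  convert (h.add h1).add h2 using 1
  module

/-- The blocks of a solution of (ODE-P) solve (ODE-Λ^N). -/
lemma IsSolP.isSolLamN {P : ℝ → Matrix (Fin N × Fin n) (Fin N × Fin n) ℝ}
    {Λ₁ Λ₂ : ℝ → Matrix (Fin n) (Fin n) ℝ} (h : p.IsSolP N P) (hT : 0 ≤ p.T) (hN : 2 ≤ N)
    (hP : ∀ t ∈ Icc 0 p.T, P t = blockPN N n (Λ₁ t) (Λ₂ t))
    (hsymm : ∀ t ∈ Icc 0 p.T, (Λ₁ t).IsSymm ∧ (Λ₂ t).IsSymm)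
    (hpos : ∀ t ∈ Icc 0 p.T, (p.R1 (Λ₁ t)).PosDef ∧ (p.R2 (Λ₁ t) (Λ₂ t)).PosDef ∧
      (p.R2 (Λ₁ t) (Λ₂ t) - (1 / (N : ℝ)) • (p.B0ᵀ * Λ₂ t * p.B0)).PosDef) :
    p.IsSolLamN N Λ₁ Λ₂ := by
  have hN0 : (N : ℝ) ≠ 0 := by positivity
  let i0 : Fin N := ⟨0, by omega⟩
  let i1 : Fin N := ⟨1, by omega⟩
  have h01 : i0 ≠ i1 := by simp [i0, i1]
  have hΛ₁ : ∀ t ∈ Icc 0 p.T, ∀ i j, Λ₁ t i j = P t (i0, i) (i0, j) := fun t ht i j => by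
    rw [hP t ht, blockPN_apply_same]
  have hΛ₂ : ∀ t ∈ Icc 0 p.T, ∀ i j, Λ₂ t i j = N * P t (i0, i) (i1, j) := fun t ht i j => by
    rw [hP t ht, blockPN_apply_ne h01, mul_div_cancel₀ _ hN0]
  have hTm : p.T ∈ Icc 0 p.T := right_mem_Icc.2 hT
  have hRic : ∀ t ∈ Icc 0 p.T, p.PRic N (P t) =
      blockPN N n (p.Ψ₁ (Λ₁ t) + p.g₁ N (Λ₁ t) (Λ₂ t))
        (p.Ψ₂ (Λ₁ t) (Λ₂ t) + p.g₂ N (Λ₁ t) (Λ₂ t)) := fun t ht => by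
    rw [hP t ht, p.PRic_blockPN hN0 _ _ (hpos t ht).1.isUnit (hpos t ht).2.2.isUnit]
  refine ⟨hsymm, hpos, ?_, ?_, fun t ht i j => ?_, fun t ht i j => ?_⟩
  · ext i j
    rw [hΛ₁ _ hTm, h.2.2.1]
    simp [bigQf, div_eq_inv_mul]
  · ext i j
    rw [hΛ₂ _ hTm, h.2.2.1]
    simp [bigQf, h01, mul_div_cancel₀ _ hN0]
  · have hd := h.2.2.2 t ht (i0, i) (i0, j)
    rw [hRic t ht, blockPN_apply_same] at hd
    exact hd.congr (fun s hs => hΛ₁ s hs i j) (hΛ₁ t ht i j)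
  · have hd := (h.2.2.2 t ht (i0, i) (i1, j)).const_mul (N : ℝ)
    rw [hRic t ht, blockPN_apply_ne h01, mul_div_cancel₀ _ hN0] at hd
    exact hd.congr (fun s hs => hΛ₂ s hs i j) (hΛ₂ t ht i j)

lemma IsSolP.isSymm_blocks {P : ℝ → Matrix (Fin N × Fin n) (Fin N × Fin n) ℝ}
    {Λ₁ Λ₂ : Matrix (Fin n) (Fin n) ℝ} (h : p.IsSolP N P) (hN : 2 ≤ N) {t : ℝ}
    (ht : t ∈ Icc 0 p.T) (hP : P t = blockPN N n Λ₁ Λ₂) : Λ₁.IsSymm ∧ Λ₂.IsSymm := by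
  have hN0 : (N : ℝ) ≠ 0 := by positivity
  let i0 : Fin N := ⟨0, by omega⟩
  let i1 : Fin N := ⟨1, by omega⟩
  have h01 : i0 ≠ i1 := by simp [i0, i1]
  have hs := h.1 t ht
  rw [hP] at hs
  constructor <;> ext i j
  · simpa only [blockPN_apply_same, Matrix.transpose_apply] using hs.apply (i0, i) (i0, j)
  · have := hs.apply (i0, i) (i1, j)
    rw [blockPN_apply_ne h01, blockPN_apply_ne h01.symm] at this
    exact (div_left_inj' hN0).1 this

end Params

/-- under asymptotic solvability, for all large N the rescaled blocks of the
solution of (ODE-P) solve (ODE-Λ^N), are uniformly bounded, and ℛ₁, ℛ₂ stay ≥ c₁ I. -/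
theorem asympSolvable_implies_solLamN {n n₁ : ℕ} (p : Params n n₁) (hp : p.Standing)
    (N₀ : ℕ) (hN₀ : 1 ≤ N₀) (c₀ C : ℝ) (hc₀ : 0 < c₀)
    (hAS : ∀ N : ℕ, N₀ ≤ N →
      ∃ P : ℝ → Matrix (Fin N × Fin n) (Fin N × Fin n) ℝ,
        p.IsSolP N P ∧
        (∀ t ∈ Icc (0 : ℝ) p.T, l1norm (P t) / (N : ℝ) ≤ C) ∧
        (∀ t ∈ Icc (0 : ℝ) p.T,
          (p.bigR N + (2 : ℝ) • p.M2 N (P t) - c₀ • 1).PosSemidef)) :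
    ∃ N₁ : ℕ, N₀ ≤ N₁ ∧ ∃ c₁ : ℝ, 0 < c₁ ∧ ∃ Cb : ℝ,
      ∀ N : ℕ, N₁ ≤ N →
        ∀ (P : ℝ → Matrix (Fin N × Fin n) (Fin N × Fin n) ℝ)
          (Λ₁ Λ₂ : ℝ → Matrix (Fin n) (Fin n) ℝ),
          p.IsSolP N P →
          (∀ t ∈ Icc (0 : ℝ) p.T, P t = blockPN N n (Λ₁ t) (Λ₂ t)) →
          (p.IsSolLamN N Λ₁ Λ₂ ∧
           (∀ t ∈ Icc (0 : ℝ) p.T, frob (Λ₁ t) + frob (Λ₂ t) ≤ Cb) ∧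
           (∀ t ∈ Icc (0 : ℝ) p.T,
             (p.R1 (Λ₁ t) - c₁ • 1).PosSemidef ∧
             (p.R2 (Λ₁ t) (Λ₂ t) - c₁ • 1).PosSemidef)) := by
  set β : ℝ := l1norm p.B0ᵀ * (2 * C) * l1norm p.B0
  refine ⟨max N₀ (max 2 ⌈2 * β / c₀⌉₊), le_max_left _ _, c₀ / 2, half_pos hc₀, 3 * C, ?_⟩
  intro N hN P Λ₁ Λ₂ hP hPΛ
  have hNN₀ : N₀ ≤ N := (le_max_left _ _).trans hN
  have hN2 : 2 ≤ N := ((le_max_left _ _).trans (le_max_right _ _)).trans hN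
  have hNβ : 2 * β / c₀ ≤ N :=
    Nat.ceil_le.1 (((le_max_right _ _).trans (le_max_right _ _)).trans hN)
  have hNpos : (0 : ℝ) < N := by positivity
  obtain ⟨P', hP', hbd, hpsd⟩ := hAS N hNN₀
  have heq : ∀ t ∈ Icc (0 : ℝ) p.T, P' t = blockPN N n (Λ₁ t) (Λ₂ t) := fun t ht =>
    (hP'.eqOn hP ht).trans (hPΛ t ht)
  have hl : ∀ t ∈ Icc (0 : ℝ) p.T, l1norm (Λ₁ t) ≤ C ∧ l1norm (Λ₂ t) ≤ 2 * C := fun t ht =>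
    l1norm_le_of_l1norm_blockPN_le hN2 (heq t ht ▸ hbd t ht)
  have hsymm : ∀ t ∈ Icc (0 : ℝ) p.T, (Λ₁ t).IsSymm ∧ (Λ₂ t).IsSymm := fun t ht =>
    hP.isSymm_blocks hN2 ht (hPΛ t ht)
  have hR : ∀ t ∈ Icc (0 : ℝ) p.T, (p.R1 (Λ₁ t) - c₀ • 1).PosSemidef ∧
      (p.R2 (Λ₁ t) (Λ₂ t) - (1 / (N : ℝ)) • (p.B0ᵀ * Λ₂ t * p.B0) - c₀ • 1).PosSemidef :=
    fun t ht => Params.posSemidef_R1_and_R2_of_blockPN hN2 (heq t ht ▸ hpsd t ht)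
  have hR2 : ∀ t ∈ Icc (0 : ℝ) p.T,
      (p.R2 (Λ₁ t) (Λ₂ t) - (c₀ / 2) • 1).PosSemidef := by
    intro t ht
    have hle : 1 / (N : ℝ) * l1norm (p.B0ᵀ * Λ₂ t * p.B0) ≤ c₀ / 2 := by
      have h1 : l1norm (p.B0ᵀ * Λ₂ t * p.B0) ≤ β :=
        (l1norm_mul_mul_le _ _ _).trans (mul_le_mul_of_nonneg_right
          (mul_le_mul_of_nonneg_left (hl t ht).2 (l1norm_nonneg _)) (l1norm_nonneg _))
      rw [div_le_iff₀ hc₀] at hNβ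
      rw [one_div_mul_eq_div, div_le_iff₀ hNpos]
      linarith
    have h2 := Params.posSemidef_R2_sub (Λ₁ t) (Λ₂ t) (hsymm t ht).2 (hR t ht).2 hle
    rwa [sub_half] at h2
  refine ⟨hP.isSolLamN hp.2.2.1.le hN2 hPΛ hsymm fun t ht => ⟨?_, ?_, ?_⟩, fun t ht => ?_,
    fun t ht => ⟨?_, hR2 t ht⟩⟩
  · exact Params.posDef_of_posSemidef_sub hc₀ (hR t ht).1
  · exact Params.posDef_of_posSemidef_sub (half_pos hc₀) (hR2 t ht)
  · exact Params.posDef_of_posSemidef_sub hc₀ (hR t ht).2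
  · have := frob_le_l1norm (Λ₁ t)
    have := frob_le_l1norm (Λ₂ t)
    have := hl t ht
    linarith
  · have h1 := (Matrix.PosSemidef.one (n := Fin n₁) (R := ℝ)).smul (half_pos hc₀).le
    convert (hR t ht).1.add h1 using 1
    module

end LQ
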